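/- arXiv:1805.06171 — 6 statements merged into one kernel-verified Lean document; each statement's English description precedes it below -/
import Mathlib

section
/- For every circuit C⃗_n of order n = k + x, with k ≥ 2, k odd, 2 ≤ x ≤ k − 1, and (x, n) ∉ {(1,4), (1,6)}, the k-labeled packing number satisfies λ^k(C⃗_n) ≥ x. -/
/-- The arc set of the circuit (directed cycle) `C⃗_n`, whose vertex set is `ZMod n`
and whose arcs go from each vertex `v` to `v + 1`. -/
def circuitArcs (n : ℕ) : Set (ZMod n × ZMod n) :=
  {a | ∃ v : ZMod n, a = (v, v + 1)}

/-- The `k` bijections `σ 1, …, σ k` from the vertices of `C⃗_n` to the vertices of the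
complete digraph `↔K_n` form a `k`-placement of `C⃗_n`: the images of the arcs of `C⃗_n`
are arcs of `↔K_n` (they join distinct vertices), and the images of the arc set of
`C⃗_n` under the `σ i` are pairwise disjoint. -/
def IsDirPlacement (n k : ℕ) (σ : Fin k → (ZMod n ≃ ZMod n)) : Prop :=
  (∀ i : Fin k, ∀ a ∈ circuitArcs n, σ i a.1 ≠ σ i a.2) ∧
  (∀ i j : Fin k, i ≠ j →
    Disjoint ((fun a => (σ i a.1, σ i a.2)) '' circuitArcs n)
      ((fun a => (σ j a.1, σ j a.2)) '' circuitArcs n))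

/-- `f`, a labeling of the `n` vertices of `↔K_n` using exactly `p` distinct labels
(i.e. a surjection onto `Fin p`), together with `k` bijections `σ 1, …, σ k`, is a
`p`-labeled packing of `k` copies of `C⃗_n` into `↔K_n`: the `σ i` form a `k`-placement
of `C⃗_n` and, for every vertex `v` of `C⃗_n`, all the images `σ i v` carry the same
label. -/
def IsDirLabeledPacking (n k p : ℕ) (f : ZMod n → Fin p)
    (σ : Fin k → (ZMod n ≃ ZMod n)) : Prop :=
  Function.Surjective f ∧ IsDirPlacement n k σ ∧
  (∀ i j : Fin k, ∀ v : ZMod n, f (σ i v) = f (σ j v))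

/-- The `k`-labeled packing number `λ^k(C⃗_n)`: the largest `p` such that there is a
`p`-labeled packing of `k` copies of `C⃗_n` into `↔K_n`. -/
noncomputable def dirLabeledPackingNumber (n k : ℕ) : ℕ :=
  sSup {p | ∃ f σ, IsDirLabeledPacking n k p f σ}

open Sum in
/-- If the vertices of `C⃗_n` are named by `ZMod q ⊕ Fin m` in such a way that no two elements of
`Fin m` are consecutive and the differences of consecutive elements of `ZMod q` are distinct, then
translating `ZMod q` and fixing `Fin m` gives an `(m + 1)`-labeled packing of `k ≤ q` copies. -/
theorem exists_isDirLabeledPacking_of_equiv {n k q m : ℕ} (hn : 1 < n) (hq : 0 < q) (hkq : k ≤ q)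
    (p : ZMod n ≃ ZMod q ⊕ Fin m)
    (hinr : ∀ v s t, p v = inr s → p (v + 1) ≠ inr t)
    (hinl : ∀ v w a a' b b', p v = inl a → p (v + 1) = inl a' → p w = inl b →
      p (w + 1) = inl b' → a' - a = b' - b → v = w) :
    ∃ f σ, IsDirLabeledPacking n k (m + 1) f σ := by
  have : Fact (1 < n) := ⟨hn⟩
  have : NeZero q := ⟨hq.ne'⟩
  let τ : Fin k → (ZMod q ⊕ Fin m ≃ ZMod q ⊕ Fin m) := fun i =>
    Equiv.sumCongr (Equiv.addRight ((i : ℕ) : ZMod q)) (Equiv.refl _)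
  let g : ZMod q ⊕ Fin m → Fin (m + 1) := Sum.elim (fun _ => 0) Fin.succ
  have cast_inj : ∀ i j : Fin k, ((i : ℕ) : ZMod q) = ((j : ℕ) : ZMod q) → i = j := by
    intro i j h
    have h' := congrArg ZMod.val h
    rw [ZMod.val_cast_of_lt (by omega), ZMod.val_cast_of_lt (by omega)] at h'
    exact Fin.ext h'
  have hg : ∀ i y, g (τ i y) = g y := by
    rintro i (y | y) <;> rfl
  refine ⟨g ∘ p, fun i => (p.trans (τ i)).trans p.symm, ?_, ⟨?_, ?_⟩, ?_⟩
  · refine Function.Surjective.comp (fun y => ?_) p.surjective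
    refine Fin.cases ⟨inl 0, rfl⟩ (fun j => ⟨inr j, rfl⟩) y
  · rintro i a ⟨v, rfl⟩ h
    have h' : v = v + 1 := ((p.trans (τ i)).trans p.symm).injective h
    simp at h'
  · intro i j hij
    rw [Set.disjoint_left]
    rintro _ ⟨_, ⟨v, rfl⟩, rfl⟩ ⟨_, ⟨w, rfl⟩, h⟩
    apply hij
    simp only [Prod.mk.injEq, Equiv.trans_apply, EmbeddingLike.apply_eq_iff_eq] at h
    obtain ⟨h₁, h₂⟩ := h
    rcases hv : p v with a | s <;> rcases hw : p w with b | t <;>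
      rcases hv' : p (v + 1) with a' | s' <;> rcases hw' : p (w + 1) with b' | t' <;>
      simp [hv, hw, hv', hw', τ] at h₁ h₂
    · have hvw : v = w := hinl v w a a' b b' hv hv' hw hw' (by linear_combination h₁ - h₂)
      subst hvw
      rw [hv] at hw
      cases hw
      exact (cast_inj j i (add_left_cancel h₁)).symm
    · subst h₂
      have hvw : v = w := add_right_cancel (p.injective (hv'.trans hw'.symm))
      subst hvw
      rw [hv] at hw
      cases hw
      exact (cast_inj j i (add_left_cancel h₁)).symm
    · subst h₁
      have hvw : v = w := p.injective (hv.trans hw.symm)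
      subst hvw
      rw [hv'] at hw'
      cases hw'
      exact (cast_inj j i (add_left_cancel h₂)).symm
    · exact absurd hv' (hinr v s s' hv)
  · intro i j v
    simp [hg]

/-- The zigzag `0, q - 1, 1, q - 2, …`, a sequencing of `ZMod q` for even `q`. -/
def zigzag (q j : ℕ) : ℕ :=
  if j % 2 = 0 then j / 2 else q - (j + 1) / 2

/-- The cyclic arrangement which alternates `m` fixed vertices with the first `m` terms of the
zigzag, and then continues along the zigzag. -/
def zigzagArrangement (q m : ℕ) (t : ℕ) : ZMod q ⊕ ℕ :=
  if t < 2 * m then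
    if t % 2 = 0 then Sum.inr (t / 2) else Sum.inl (zigzag q (t / 2) : ℕ)
  else Sum.inl (zigzag q (t - m) : ℕ)

theorem zigzag_lt {q j : ℕ} (hj : j < q) : zigzag q j < q := by
  unfold zigzag
  split_ifs <;> omega

theorem zigzag_cast_injOn {q a b : ℕ} (ha : a < q) (hb : b < q)
    (h : (zigzag q a : ZMod q) = (zigzag q b : ℕ)) : a = b := by
  have h' := congrArg ZMod.val h
  rw [ZMod.val_cast_of_lt (zigzag_lt ha), ZMod.val_cast_of_lt (zigzag_lt hb)] at h'
  unfold zigzag at h'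
  split_ifs at h' <;> omega

theorem zigzag_sub_injOn {q a b : ℕ} (hq : Even q) (ha : a + 1 < q) (hb : b + 1 < q)
    (h : (zigzag q (a + 1) : ZMod q) - (zigzag q a : ℕ) =
      (zigzag q (b + 1) : ℕ) - (zigzag q b : ℕ)) : a = b := by
  obtain ⟨r, rfl⟩ := hq
  have h₁ : (((zigzag (r + r) (a + 1) : ℤ) - zigzag (r + r) a -
      (zigzag (r + r) (b + 1) - zigzag (r + r) b) : ℤ) : ZMod (r + r)) = 0 := by
    push_cast
    rw [sub_eq_zero]
    exact_mod_cast h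
  rw [ZMod.intCast_zmod_eq_zero_iff_dvd] at h₁
  obtain ⟨c, hc⟩ := h₁
  have l₁ := zigzag_lt ha
  have l₂ := zigzag_lt hb
  have l₃ := zigzag_lt (Nat.lt_of_succ_lt ha)
  have l₄ := zigzag_lt (Nat.lt_of_succ_lt hb)
  have hc₁ : c < 2 := by
    by_contra! hc'
    push_cast at hc
    nlinarith
  have hc₂ : -2 < c := by
    by_contra! hc'
    push_cast at hc
    nlinarith
  unfold zigzag at hc
  interval_cases c <;> split_ifs at hc <;> omega

theorem zigzagArrangement_injOn {q m s t : ℕ} (hm : m ≤ q) (hs : s < q + m) (ht : t < q + m)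
    (h : zigzagArrangement q m s = zigzagArrangement q m t) : s = t := by
  unfold zigzagArrangement at h
  split_ifs at h <;> simp only [Sum.inl.injEq, Sum.inr.injEq] at h
  · omega
  all_goals
    have := zigzag_cast_injOn (by omega) (by omega) h
    omega

theorem zigzagArrangement_eq_inr {q m t j : ℕ} (h : zigzagArrangement q m t = Sum.inr j) :
    t = 2 * j ∧ j < m := by
  unfold zigzagArrangement at h
  split_ifs at h
  simp only [Sum.inr.injEq] at h
  omega

theorem zigzagArrangement_eq_inl {q m t : ℕ} {a : ZMod q}
    (h : zigzagArrangement q m t = Sum.inl a) :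
    (t < 2 * m ∧ t % 2 = 1 ∧ a = (zigzag q (t / 2) : ℕ)) ∨
      (2 * m ≤ t ∧ a = (zigzag q (t - m) : ℕ)) := by
  unfold zigzagArrangement at h
  split_ifs at h <;> simp only [Sum.inl.injEq] at h
  · exact Or.inl ⟨by omega, by omega, h.symm⟩
  · exact Or.inr ⟨by omega, h.symm⟩

theorem zigzagArrangement_succ {q m t : ℕ} {a b : ZMod q} (ht : t + 1 < q + m)
    (ha : zigzagArrangement q m t = Sum.inl a) (hb : zigzagArrangement q m (t + 1) = Sum.inl b) :
    ∃ j, j + m = t ∧ j + 1 < q ∧ a = (zigzag q j : ℕ) ∧ b = (zigzag q (j + 1) : ℕ) := by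
  rcases zigzagArrangement_eq_inl ha with ⟨h₁, h₂, rfl⟩ | ⟨h₁, rfl⟩ <;>
    rcases zigzagArrangement_eq_inl hb with ⟨h₃, h₄, rfl⟩ | ⟨h₃, rfl⟩
  · omega
  · refine ⟨t - m, by omega, by omega, ?_, ?_⟩
    · rw [show t / 2 = t - m by omega]
    · rw [show t - m + 1 = t + 1 - m by omega]
  · omega
  · refine ⟨t - m, by omega, by omega, rfl, ?_⟩
    rw [show t - m + 1 = t + 1 - m by omega]

theorem exists_isDirLabeledPacking_of_even {n k q m : ℕ} (hq : Even q) (hkq : k ≤ q) (hm : 0 < m)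
    (hmq : m ≤ q) (hn : n = q + m) : ∃ f σ, IsDirLabeledPacking n k (m + 1) f σ := by
  have : NeZero m := ⟨hm.ne'⟩
  have : NeZero q := ⟨by omega⟩
  have : NeZero n := ⟨by omega⟩
  have : Fact (1 < n) := ⟨by omega⟩
  let F : ZMod n → ZMod q ⊕ Fin m := fun v =>
    Sum.map id (Fin.ofNat m) (zigzagArrangement q m v.val)
  have hlt : ∀ v : ZMod n, v.val < q + m := fun v => hn ▸ v.val_lt
  have Finl : ∀ v a, F v = Sum.inl a → zigzagArrangement q m v.val = Sum.inl a := by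
    intro v a h
    rcases hv : zigzagArrangement q m v.val with b | j <;> simp_all [F]
  have Finr : ∀ v s, F v = Sum.inr s → zigzagArrangement q m v.val = Sum.inr (s : ℕ) := by
    intro v s h
    rcases hv : zigzagArrangement q m v.val with b | j
    · simp [F, hv] at h
    · obtain ⟨-, hj⟩ := zigzagArrangement_eq_inr hv
      simp only [F, hv, Sum.map_inr, Sum.inr.injEq] at h
      rw [← h, Fin.val_ofNat, Nat.mod_eq_of_lt hj]
  have hF : Function.Injective F := by
    intro v w h
    apply ZMod.val_injective n
    apply zigzagArrangement_injOn hmq (hlt v) (hlt w)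
    rcases hw : F w with a | s
    · rw [Finl w a hw, Finl v a (h.trans hw)]
    · rw [Finr w s hw, Finr v s (h.trans hw)]
  have hval : ∀ v : ZMod n, (v + 1).val = v.val + 1 ∧ v.val + 1 < q + m ∨
      v.val + 1 = q + m ∧ (v + 1).val = 0 := by
    intro v
    have hv := hlt v
    have h := ZMod.val_add v 1
    rw [ZMod.val_one] at h
    rcases Nat.lt_or_ge (v.val + 1) (q + m) with h' | h'
    · rw [Nat.mod_eq_of_lt (hn ▸ h')] at h
      exact Or.inl ⟨h, h'⟩
    · have h'' : v.val + 1 = q + m := by omega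
      rw [h'', ← hn, Nat.mod_self] at h
      exact Or.inr ⟨h'', h⟩
  have arr_zero : zigzagArrangement q m 0 = Sum.inr 0 := by
    simp [zigzagArrangement, hm]
  have key : ∀ v a b, F v = Sum.inl a → F (v + 1) = Sum.inl b →
      ∃ j, j + m = v.val ∧ j + 1 < q ∧ a = (zigzag q j : ℕ) ∧ b = (zigzag q (j + 1) : ℕ) := by
    intro v a b ha hb
    have hb := Finl _ _ hb
    rcases hval v with ⟨h, h'⟩ | ⟨-, h⟩ <;> rw [h] at hb
    · exact zigzagArrangement_succ h' (Finl _ _ ha) hb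
    · simp [arr_zero] at hb
  have hbij : Function.Bijective F := by
    rw [Fintype.bijective_iff_injective_and_card]
    exact ⟨hF, by simp [ZMod.card, hn]⟩
  refine exists_isDirLabeledPacking_of_equiv (by omega) (by omega) hkq (Equiv.ofBijective F hbij)
    ?_ ?_
  · intro v s t hs ht
    obtain ⟨h₁, h₂⟩ := zigzagArrangement_eq_inr (Finr _ _ hs)
    obtain ⟨h₃, h₄⟩ := zigzagArrangement_eq_inr (Finr _ _ ht)
    rcases hval v with h | h <;> omega
  · intro v w a a' b b' ha ha' hb hb' h
    obtain ⟨i, hi, hiq, rfl, rfl⟩ := key v a a' ha ha'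
    obtain ⟨j, hj, hjq, rfl, rfl⟩ := key w b b' hb hb'
    apply ZMod.val_injective n
    rw [← hi, ← hj, zigzag_sub_injOn hq hiq hjq h]

theorem le_dirLabeledPackingNumber {n k p : ℕ} [NeZero n]
    (h : ∃ f σ, IsDirLabeledPacking n k p f σ) : p ≤ dirLabeledPackingNumber n k := by
  refine le_csSup ⟨n, ?_⟩ h
  rintro r ⟨f, σ, hf, -⟩
  simpa [ZMod.card] using Fintype.card_le_of_surjective f hf

/-- For every circuit `C⃗_n` of order `n = k + x`, with `k ≥ 2`, `k`
odd, `2 ≤ x ≤ k − 1`, and `(x, n) ∉ {(1,4), (1,6)}`, we have `λ^k(C⃗_n) ≥ x`. -/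
theorem dirLabeledPackingNumber_ge_of_odd (k x : ℕ) (hk : 2 ≤ k) (hko : Odd k)
    (hx1 : 2 ≤ x) (hx2 : x ≤ k - 1)
    (h4 : ¬(x = 1 ∧ k + x = 4)) (h6 : ¬(x = 1 ∧ k + x = 6)) :
    x ≤ dirLabeledPackingNumber (k + x) k := by
  obtain ⟨m, rfl⟩ : ∃ m, x = m + 1 := ⟨x - 1, by omega⟩
  have : NeZero (k + (m + 1)) := ⟨by omega⟩
  exact le_dirLabeledPackingNumber (exists_isDirLabeledPacking_of_even (q := k + 1)
    hko.add_one (by omega) (by omega) (by omega) (by omega))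
end

section
/- Let C⃗_n be the circuit of order n = k + x with k ≥ 2, 1 ≤ x ≤ k − 1, and (x, n) ∉ {(1,4), (1,6)}, let f be a p-labeled packing of k copies of C⃗_n, and let q be the minimum, over the p labels, of the number of vertices carrying that label. Then there exists a set of at least k vertices of C⃗_n whose vertices carry, in total, at most q distinct labels. -/
/-- In a placement, distinct pairs (copy, vertex of the circuit) give distinct arcs. -/
theorem IsDirPlacement.injective_arc {n k : ℕ} {σ : Fin k → (ZMod n ≃ ZMod n)}
    (h : IsDirPlacement n k σ) :
    Function.Injective fun c : Fin k × ZMod n => (σ c.1 c.2, σ c.1 (c.2 + 1)) := by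
  rintro ⟨i, v⟩ ⟨j, w⟩ hvw
  obtain rfl : i = j := by
    by_contra hij
    exact Set.disjoint_left.mp (h.2 i j hij)
      ⟨(v, v + 1), ⟨v, rfl⟩, rfl⟩ ⟨(w, w + 1), ⟨w, rfl⟩, hvw.symm⟩
  exact congrArg (Prod.mk i) ((σ i).injective (Prod.ext_iff.mp hvw).1)

/-- Let `C⃗_n` be the circuit of order `n = k + x` with `k ≥ 2`,
`1 ≤ x ≤ k − 1`, and `(x, n) ∉ {(1,4), (1,6)}`, let `f` (with bijections `σ`) be a
`p`-labeled packing of `k` copies of `C⃗_n`, and let `q` be the minimum, over the `p`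
labels, of the number of vertices carrying that label. Then there is a set of at least
`k` vertices whose vertices carry, in total, at most `q` distinct labels. -/
theorem exists_big_set_few_labels_dir (k x p q : ℕ) (hk : 2 ≤ k)
    (hx1 : 1 ≤ x) (hx2 : x ≤ k - 1)
    (h4 : ¬(x = 1 ∧ k + x = 4)) (h6 : ¬(x = 1 ∧ k + x = 6))
    (f : ZMod (k + x) → Fin p) (σ : Fin k → (ZMod (k + x) ≃ ZMod (k + x)))
    (hpack : IsDirLabeledPacking (k + x) k p f σ)
    (hqmem : ∃ i : Fin p, {v : ZMod (k + x) | f v = i}.ncard = q)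
    (hqle : ∀ i : Fin p, q ≤ {v : ZMod (k + x) | f v = i}.ncard) :
    ∃ S : Set (ZMod (k + x)), k ≤ S.ncard ∧ (f '' S).ncard ≤ q := by
  have : NeZero (k + x) := ⟨by omega⟩
  obtain ⟨hsurj, hplace, hlab⟩ := hpack
  obtain ⟨a, ha⟩ := hqmem
  let i₀ : Fin k := ⟨0, by omega⟩
  have hlab₀ (i : Fin k) (v : ZMod (k + x)) : f (σ i v) = f (σ i₀ v) := hlab i i₀ v
  set A : Set (ZMod (k + x)) := {v | f v = a}
  set A' : Set (ZMod (k + x)) := σ i₀ ⁻¹' A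
  have hA' : A'.ncard = q := by
    rw [← ha, ← Set.ncard_image_of_injective A' (σ i₀).injective,
      (σ i₀).surjective.image_preimage]
  have hq : 0 < q := by
    obtain ⟨v, hv⟩ := hsurj a
    rw [← ha]
    exact (Set.ncard_pos).mpr ⟨v, hv⟩
  set B : Set (Fin p) := (fun v => f (σ i₀ (v + 1))) '' A'
  refine ⟨f ⁻¹' B, ?_, ?_⟩
  · have hle : ((Set.univ : Set (Fin k)) ×ˢ A').ncard ≤ (A ×ˢ (f ⁻¹' B)).ncard := by
      refine Set.ncard_le_ncard_of_injOn _ ?_ hplace.injective_arc.injOn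
      rintro ⟨i, v⟩ ⟨-, hv⟩
      exact ⟨(hlab₀ i v).trans hv, v, hv, (hlab₀ i (v + 1)).symm⟩
    rw [Set.ncard_prod, Set.ncard_prod, Set.ncard_univ, Nat.card_eq_fintype_card,
      Fintype.card_fin, hA', ha, mul_comm] at hle
    exact Nat.le_of_mul_le_mul_left hle hq
  · calc (f '' (f ⁻¹' B)).ncard ≤ B.ncard := Set.ncard_le_ncard (Set.image_preimage_subset f B)
      _ ≤ A'.ncard := Set.ncard_image_le
      _ = q := hA'
end

section
/- Let C⃗_n be the circuit of order n = k + x with k ≥ 2, 1 ≤ x ≤ k − 1, and (x, n) ∉ {(1,4), (1,6)}, let f be a p-labeled packing of k copies of C⃗_n, and let q be the minimum, over the p labels, of the number of vertices carrying that label. If q ≤ x, then p ≤ x + 2. -/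
/-- The out-neighbours of a fixed vertex in the copies of a placement are pairwise distinct. -/
theorem outNeighbor_injective {n k : ℕ} {σ : Fin k → (ZMod n ≃ ZMod n)}
    (h : IsDirPlacement n k σ) (w : ZMod n) :
    Function.Injective fun i : Fin k => σ i ((σ i).symm w + 1) := by
  intro i j hij
  by_contra hne
  have hi : (w, σ i ((σ i).symm w + 1)) ∈
      (fun a => (σ i a.1, σ i a.2)) '' circuitArcs n :=
    ⟨((σ i).symm w, (σ i).symm w + 1), ⟨_, rfl⟩, by simp⟩
  have hj : (w, σ i ((σ i).symm w + 1)) ∈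
      (fun a => (σ j a.1, σ j a.2)) '' circuitArcs n :=
    ⟨((σ j).symm w, (σ j).symm w + 1), ⟨_, rfl⟩, by simpa using hij.symm⟩
  exact Set.disjoint_left.mp (h.2 i j hne) hi hj

/-- Let `C⃗_n` be the circuit of order `n = k + x` with `k ≥ 2`,
`1 ≤ x ≤ k − 1`, and `(x, n) ∉ {(1,4), (1,6)}`, let `f` (with bijections `σ`) be a
`p`-labeled packing of `k` copies of `C⃗_n`, and let `q` be the minimum, over the `p`
labels, of the number of vertices carrying that label. If `q ≤ x`, then `p ≤ x + 2`. -/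
theorem labels_le_of_small_min_label_class_dir (k x p q : ℕ) (hk : 2 ≤ k)
    (hx1 : 1 ≤ x) (hx2 : x ≤ k - 1)
    (h4 : ¬(x = 1 ∧ k + x = 4)) (h6 : ¬(x = 1 ∧ k + x = 6))
    (f : ZMod (k + x) → Fin p) (σ : Fin k → (ZMod (k + x) ≃ ZMod (k + x)))
    (hpack : IsDirLabeledPacking (k + x) k p f σ)
    (hqmem : ∃ i : Fin p, {v : ZMod (k + x) | f v = i}.ncard = q)
    (hqle : ∀ i : Fin p, q ≤ {v : ZMod (k + x) | f v = i}.ncard)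
    (hq : q ≤ x) :
    p ≤ x + 2 := by
  have : NeZero (k + x) := ⟨by omega⟩
  have : NeZero k := ⟨by omega⟩
  obtain ⟨hsurj, hplace, hlab⟩ := hpack
  obtain ⟨i, hi⟩ := hqmem
  obtain ⟨w, rfl⟩ := hsurj i
  have hcard (j : Fin p) :
      {v : ZMod (k + x) | f v = j}.ncard = (Finset.univ.filter fun v => f v = j).card := by
    rw [← Set.ncard_coe_finset]
    simp
  have hq_pos : 1 ≤ q := by
    rw [← hi, hcard]
    exact Finset.card_pos.mpr ⟨w, by simp⟩
  -- the labels met by the arcs leaving the label class of `w`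
  let T : Finset (Fin p) :=
    (Finset.univ.filter fun v => f (σ 0 v) = f w).image fun v => f (σ 0 (v + 1))
  have hT : T.card ≤ q := by
    refine Finset.card_image_le.trans ?_
    rw [← hi, hcard]
    refine Finset.card_le_card_of_injOn (σ 0) ?_ (σ 0).injective.injOn
    intro v hv
    simpa using hv
  have hout := outNeighbor_injective hplace w
  let A : Finset (ZMod (k + x)) := Finset.univ.filter fun v => f v ∉ T
  have hA : A.card ≤ x := by
    have hdisj :
        Disjoint A (Finset.univ.image fun i : Fin k => σ i ((σ i).symm w + 1)) := by
      refine Finset.disjoint_right.mpr fun u hu huA => ?_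
      obtain ⟨i, -, rfl⟩ := Finset.mem_image.mp hu
      refine (Finset.mem_filter.mp huA).2 (Finset.mem_image.mpr ⟨(σ i).symm w, ?_, ?_⟩)
      · simpa using hlab 0 i ((σ i).symm w)
      · exact hlab 0 i _
    have hle := Finset.card_le_univ
      (A ∪ Finset.univ.image fun i : Fin k => σ i ((σ i).symm w + 1))
    rw [Finset.card_union_of_disjoint hdisj, Finset.card_image_of_injective _ hout,
      Finset.card_univ, Fintype.card_fin, ZMod.card] at hle
    omega
  have hAT : Tᶜ.card * q ≤ A.card := by
    have hmaps : ∀ v ∈ A, f v ∈ Tᶜ := fun v hv => by simpa [A] using hv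
    rw [Finset.card_eq_sum_card_fiberwise hmaps, ← smul_eq_mul]
    refine Finset.card_nsmul_le_sum _ _ _ fun j hj => ?_
    refine (hqle j).trans ?_
    rw [hcard]
    refine Finset.card_le_card fun v hv => ?_
    have hv : f v = j := by simpa using hv
    simp only [A, Finset.mem_filter, Finset.mem_univ, true_and]
    exact ⟨by simpa [hv] using hj, hv⟩
  have hp : T.card + Tᶜ.card = p := by simp [Finset.card_add_card_compl]
  rcases Nat.eq_zero_or_pos Tᶜ.card with h0 | hpos
  · omega
  · obtain ⟨a, ha⟩ := Nat.exists_eq_add_of_le hpos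
    obtain ⟨b, rfl⟩ := Nat.exists_eq_add_of_le hq_pos
    rw [ha] at hAT hp
    nlinarith [Nat.zero_le (a * b)]
end

section
/- Let C⃗_n be the circuit of order n = k + x with k ≥ 2, 1 ≤ x ≤ k − 1, and (x, n) ∉ {(1,4), (1,6)}. If x ≥ √(k − 1), then λ^k(C⃗_n) ≤ x + 2. -/
open Finset in
/-- A family of positive class sizes with total `k + x` in which the classes incompatible with a
smallest class have total size at most `x - 1` has at most `x + 2` members. -/
theorem card_le_of_sum_eq_of_sum_filter_lt {p k x : ℕ} (hxk : x < k) (hkx : k ≤ x ^ 2 + 1)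
    (a : Fin p → ℕ) (ha : ∀ j, 1 ≤ a j) (hsum : ∑ j, a j = k + x) (i : Fin p)
    (hmin : ∀ j, a i ≤ a j) (hJ : ∑ j with j ≠ i ∧ a i * a j < k, a j + 1 ≤ x) :
    p ≤ x + 2 := by
  by_contra! hp
  set b := a i with hb
  set J := univ.filter fun j => j ≠ i ∧ b * a j < k
  set R := univ.filter fun j => j ≠ i ∧ ¬ b * a j < k
  have hsplit (g : Fin p → ℕ) : ∑ j, g j = g i + (∑ j ∈ J, g j + ∑ j ∈ R, g j) := by
    rw [← add_sum_erase univ g (mem_univ i),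
      ← sum_filter_add_sum_filter_not (univ.erase i) (fun j => b * a j < k)]
    congr 3 <;> ext j <;> simp [J, R]
  have hcard : p = 1 + (#J + #R) := by simpa using hsplit fun _ => 1
  have hJb : #J * b ≤ ∑ j ∈ J, a j := by
    simpa using card_nsmul_le_sum J a b fun j _ => hmin j
  have hRk : #R * k ≤ b * ∑ j ∈ R, a j := by
    rw [mul_sum]
    simpa using card_nsmul_le_sum R (fun j => b * a j) k fun j hj => by
      simpa [R] using (mem_filter.1 hj).2.2
  have hpb : p * b ≤ k + x := by
    rw [← hsum]
    simpa using card_nsmul_le_sum univ a b fun j _ => hmin j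
  have hb1 : 1 ≤ b := ha i
  have htot := hsplit a
  rw [hsum, ← hb] at htot
  have hJ0 : k < b * b → #J = 0 := fun h => by
    rw [card_eq_zero, filter_eq_empty_iff]
    rintro j - ⟨-, hj⟩
    nlinarith [Nat.mul_le_mul_left b (hmin j)]
  have hbx : b ≤ x := by
    by_contra! h
    nlinarith [Nat.mul_le_mul hp h]
  obtain ⟨c, rfl⟩ := Nat.exists_eq_add_of_le hbx
  obtain ⟨d, hd⟩ := Nat.exists_eq_add_of_le hb1
  have hkey : b + c < b * (c + 3) := by rw [hd]; nlinarith [Nat.zero_le (d * c)]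
  have hpb' : (b + c + 3) * b ≤ p * b := Nat.mul_le_mul_right b hp
  obtain hkb | hkb := lt_or_ge k (b * b)
  · nlinarith
  · have hRb : b ≤ #R := by
      by_contra! h
      nlinarith
    obtain ⟨t, ht⟩ := Nat.exists_eq_add_of_le hRb
    have h1 : b * (k + (b + c)) = b * b + b * ∑ j ∈ J, a j + b * ∑ j ∈ R, a j := by
      rw [htot]; ring
    have h2 := Nat.mul_le_mul_left b hJb
    have h3 := Nat.mul_le_mul_left t hkb
    have h4 : b * b * (c + 3) ≤ b * b * (1 + (#J + t)) := Nat.mul_le_mul_left _ (by omega)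
    have h5 := Nat.mul_lt_mul_of_pos_left hkey hb1
    rw [ht] at hRk
    nlinarith

namespace IsDirLabeledPacking

open Finset

variable {n k p : ℕ} {f : ZMod n → Fin p} {σ : Fin k → (ZMod n ≃ ZMod n)}

/-- An arc belongs to at most one copy of the circuit. -/
theorem copy_eq (h : IsDirLabeledPacking n k p f σ) {c d : Fin k} {v w : ZMod n}
    (h1 : σ c v = σ d w) (h2 : σ c (v + 1) = σ d (w + 1)) : c = d := by
  by_contra hcd
  exact Set.disjoint_left.1 (h.2.1.2 c d hcd) ⟨(v, v + 1), ⟨v, rfl⟩, rfl⟩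
    ⟨(w, w + 1), ⟨w, rfl⟩, Prod.ext h1.symm h2.symm⟩

/-- If the circuit has an arc whose ends lie in two given label classes, then the product of the
class sizes is at least the number of copies. -/
theorem le_card_mul_card [NeZero n] (h : IsDirLabeledPacking n k p f σ) (c : Fin k) (v : ZMod n) :
    k ≤ #{u | f u = f (σ c v)} * #{u | f u = f (σ c (v + 1))} := by
  rw [← card_product]
  refine le_trans (by simp) (card_le_card_of_injOn (s := (univ : Finset (Fin k)))
    (fun d => (σ d v, σ d (v + 1))) (fun d _ => ?_) fun d _ e _ hde => ?_)
  · simp [h.2.2 d c]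
  · exact h.copy_eq (Prod.ext_iff.1 hde).1 (Prod.ext_iff.1 hde).2

/-- The classes which are too small to be joined by an arc to the class of `u` consist of vertices
which are not out-neighbours of `u` in any copy. -/
theorem sum_card_add_le [NeZero n] (h : IsDirLabeledPacking n k p f σ) (u : ZMod n) :
    ∑ j with j ≠ f u ∧ #{w | f w = f u} * #{w | f w = j} < k, #{w | f w = j} + 1 + k ≤ n := by
  set J := univ.filter fun j => j ≠ f u ∧ #{w | f w = f u} * #{w | f w = j} < k with hJ
  let S : Finset (ZMod n) := univ.filter fun w => f w ∈ J
  have hS : ∑ j ∈ J, #{w | f w = j} = #S := by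
    rw [card_eq_sum_card_fiberwise (f := f) (s := S) (t := J) fun w hw => by simpa [S] using hw]
    refine sum_congr rfl fun j hj => congrArg card ?_
    ext w
    simp only [S, mem_filter, mem_univ, true_and]
    exact ⟨fun hw => ⟨hw ▸ hj, hw⟩, fun hw => hw.2⟩
  let out : Fin k → ZMod n := fun c => σ c ((σ c).symm u + 1)
  have hout : Function.Injective out := fun c d hcd =>
    h.copy_eq (v := (σ c).symm u) (w := (σ d).symm u) (by simp) hcd
  have huS : u ∉ S := by simp [S, hJ]
  have hdisj : Disjoint (insert u S) (univ.image out) := by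
    rw [disjoint_right]
    intro w hw hwS
    obtain ⟨c, -, rfl⟩ := mem_image.1 hw
    have hne := h.2.1.1 c ((σ c).symm u, (σ c).symm u + 1) ⟨_, rfl⟩
    have hle := h.le_card_mul_card c ((σ c).symm u)
    rw [Equiv.apply_symm_apply] at hne hle
    obtain heq | hwS := mem_insert.1 hwS
    · exact hne heq.symm
    · exact absurd hle (by simpa [S, hJ, out] using (mem_filter.1 (mem_filter.1 hwS).2).2.2)
  have hcard := card_le_univ (insert u S ∪ univ.image out)
  rwa [card_union_of_disjoint hdisj, card_insert_of_notMem huS, card_image_of_injective _ hout,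
    card_univ, Fintype.card_fin, ZMod.card, ← hS] at hcard

end IsDirLabeledPacking

/-- Let `C⃗_n` be the circuit of order `n = k + x` with `k ≥ 2`,
`1 ≤ x ≤ k − 1`, and `(x, n) ∉ {(1,4), (1,6)}`. If `x ≥ √(k − 1)`, then
`λ^k(C⃗_n) ≤ x + 2`. -/
theorem dirLabeledPackingNumber_le_of_sqrt (k x : ℕ) (hk : 2 ≤ k)
    (hx1 : 1 ≤ x) (hx2 : x ≤ k - 1)
    (h4 : ¬(x = 1 ∧ k + x = 4)) (h6 : ¬(x = 1 ∧ k + x = 6))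
    (hsqrt : Real.sqrt ((k : ℝ) - 1) ≤ (x : ℝ)) :
    dirLabeledPackingNumber (k + x) k ≤ x + 2 := by
  have hkx : k ≤ x ^ 2 + 1 := by
    have := (Real.sqrt_le_left (by positivity)).1 hsqrt
    have : (k : ℝ) ≤ ((x ^ 2 + 1 : ℕ) : ℝ) := by push_cast; linarith
    exact_mod_cast this
  have : NeZero (k + x) := ⟨by omega⟩
  refine csSup_le' ?_
  rintro p ⟨f, σ, h⟩
  let a : Fin p → ℕ := fun j => (Finset.univ.filter fun w => f w = j).card
  have hpos (j : Fin p) : 1 ≤ a j := by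
    obtain ⟨w, hw⟩ := h.1 j
    exact Finset.card_pos.2 ⟨w, by simpa using hw⟩
  have hsum : ∑ j, a j = k + x := by
    rw [← Finset.card_eq_sum_card_fiberwise fun _ _ => Finset.mem_coe.2 (Finset.mem_univ _),
      Finset.card_univ, ZMod.card]
  have : Nonempty (Fin p) := ⟨f 0⟩
  obtain ⟨i, hi⟩ := Finite.exists_min a
  obtain ⟨u, rfl⟩ := h.1 i
  have hJ := h.sum_card_add_le u
  exact card_le_of_sum_eq_of_sum_filter_lt (by omega) hkx a hpos hsum (f u) hi
    (by simp only [a]; omega)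
end

section
/- Let C⃗_n be the circuit of order n = k + x with (x, n) ∉ {(1,4), (1,6)}. For every positive integer p with p ≤ λ^k(C⃗_n), there exists a partition n_1, n_2, …, n_p of n into p positive parts such that Σ_{i=1}^{p} ⌊n_i(n_i − 1)/k⌋ + Σ_{i=1}^{p} Σ_{j=i+1}^{p} ⌊2 n_i n_j / k⌋ ≥ n. -/
/-- Merging labels along a surjection preserves labeled packings. -/
theorem IsDirLabeledPacking.comp {n k p q : ℕ} {f : ZMod n → Fin p}
    {σ : Fin k → (ZMod n ≃ ZMod n)} (h : IsDirLabeledPacking n k p f σ) {g : Fin p → Fin q}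
    (hg : Function.Surjective g) : IsDirLabeledPacking n k q (g ∘ f) σ :=
  ⟨hg.comp h.1, h.2.1, fun i j v => congrArg g (h.2.2 i j v)⟩

/-- Distinct (copy, vertex) pairs of a placement give distinct arcs. -/
theorem IsDirPlacement.injective {n k : ℕ} {σ : Fin k → (ZMod n ≃ ZMod n)}
    (h : IsDirPlacement n k σ) :
    Function.Injective fun q : Fin k × ZMod n => (σ q.1 q.2, σ q.1 (q.2 + 1)) := by
  rintro ⟨i, v⟩ ⟨j, w⟩ hvw
  by_cases hij : i = j
  · subst hij
    simp only [Prod.mk.injEq, EmbeddingLike.apply_eq_iff_eq] at hvw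
    rw [hvw.1]
  · exact (Set.disjoint_left.1 (h.2 i j hij) ⟨(v, v + 1), ⟨v, rfl⟩, rfl⟩
      ⟨(w, w + 1), ⟨w, rfl⟩, hvw.symm⟩).elim

/-- If every copy maps each arc `(v, v + 1)` with `v ∈ A` to an arc in `B`, then
`k * |A| ≤ |B|`. -/
theorem IsDirPlacement.mul_card_le {n k : ℕ} {σ : Fin k → (ZMod n ≃ ZMod n)}
    (h : IsDirPlacement n k σ) (A : Finset (ZMod n)) (B : Finset (ZMod n × ZMod n))
    (hAB : ∀ i, ∀ v ∈ A, (σ i v, σ i (v + 1)) ∈ B) : k * A.card ≤ B.card := by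
  have hle := Finset.card_le_card_of_injOn (s := Finset.univ ×ˢ A) (t := B)
    (fun q : Fin k × ZMod n => (σ q.1 q.2, σ q.1 (q.2 + 1)))
    (fun q hq => hAB q.1 q.2 (Finset.mem_product.1 hq).2) h.injective.injOn
  simpa using hle

/-- A double sum splits into its diagonal and the pairs `i < j`. -/
theorem Fin.sum_sum_eq_sum_diag_add_sum_lt {p : ℕ} (F : Fin p → Fin p → ℕ) :
    ∑ i, ∑ j, F i j =
      ∑ i, F i i + ∑ i, ∑ j ∈ Finset.univ.filter (fun j => i < j), (F i j + F j i) := by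
  simp only [Finset.filter_lt_eq_Ioi]
  rw [Finset.sum_sum_Ioi_add_eq_sum_sum_off_diag fun i j => F j i, ← Finset.sum_add_distrib]
  exact Finset.sum_congr rfl fun i _ => Fintype.sum_eq_add_sum_compl i _

/-- The sizes of the label classes of a labeled packing satisfy the counting inequality. -/
theorem IsDirLabeledPacking.exists_partition {n k p : ℕ} [NeZero n] (hk : 0 < k)
    {f : ZMod n → Fin p} {σ : Fin k → (ZMod n ≃ ZMod n)} (h : IsDirLabeledPacking n k p f σ) :
    ∃ parts : Fin p → ℕ, (∀ i, 0 < parts i) ∧ (∑ i, parts i = n) ∧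
      n ≤ (∑ i, parts i * (parts i - 1) / k) +
          ∑ i, ∑ j ∈ Finset.univ.filter (fun j => i < j), 2 * (parts i * parts j) / k := by
  obtain ⟨hf, hσ, hfσ⟩ := h
  let g : ZMod n → Fin p := fun v => f (σ ⟨0, hk⟩ v)
  have hg : ∀ i v, f (σ i v) = g v := fun i v => hfσ i _ v
  let C : Fin p → Finset (ZMod n) := fun a => Finset.univ.filter (fun v => f v = a)
  let A : Fin p → Fin p → Finset (ZMod n) := fun a b =>
    Finset.univ.filter (fun v => g v = a ∧ g (v + 1) = b)
  have hdiag : ∀ a, k * (A a a).card ≤ (C a).card * ((C a).card - 1) := by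
    intro a
    rw [Nat.mul_sub_one, ← Finset.offDiag_card]
    refine hσ.mul_card_le _ _ fun i v hv => ?_
    have hne := hσ.1 i (v, v + 1) ⟨v, rfl⟩
    simp_all [A, C]
  have hoff : ∀ a b, k * (A a b).card ≤ (C a).card * (C b).card := by
    intro a b
    rw [← Finset.card_product]
    refine hσ.mul_card_le _ _ fun i v hv => ?_
    simp_all [A, C]
  have hsum : ∑ a, ∑ b, (A a b).card = n := by
    rw [← Fintype.sum_prod_type' (f := fun a b => (A a b).card)]
    have := Finset.card_eq_sum_card_fiberwise (s := (Finset.univ : Finset (ZMod n)))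
      (t := Finset.univ) (f := fun v => (g v, g (v + 1)))
      (fun _ _ => Finset.mem_coe.2 (Finset.mem_univ _))
    simpa [A, Prod.ext_iff, ZMod.card] using this.symm
  refine ⟨fun a => (C a).card, fun a => ?_, ?_, ?_⟩
  · obtain ⟨v, hv⟩ := hf a
    exact Finset.card_pos.2 ⟨v, by simp [C, hv]⟩
  · have := Finset.card_eq_sum_card_fiberwise (s := (Finset.univ : Finset (ZMod n)))
      (t := Finset.univ) (f := f) (fun _ _ => Finset.mem_coe.2 (Finset.mem_univ _))
    simpa [C, ZMod.card] using this.symm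
  · rw [Fin.sum_sum_eq_sum_diag_add_sum_lt] at hsum
    refine hsum.symm.le.trans (add_le_add ?_ ?_)
    · refine Finset.sum_le_sum fun a _ => (Nat.le_div_iff_mul_le hk).2 ?_
      linarith [hdiag a]
    · refine Finset.sum_le_sum fun a _ => Finset.sum_le_sum fun b _ =>
        (Nat.le_div_iff_mul_le hk).2 ?_
      linarith [hoff a b, hoff b a]

/-- A labeled packing attaining a positive labeled packing number exists. -/
theorem exists_isDirLabeledPacking_dirLabeledPackingNumber {n k : ℕ} [NeZero n]
    (h : 0 < dirLabeledPackingNumber n k) :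
    ∃ f σ, IsDirLabeledPacking n k (dirLabeledPackingNumber n k) f σ := by
  refine Nat.sSup_mem (s := {p | ∃ f σ, IsDirLabeledPacking n k p f σ}) ?_ ⟨n, ?_⟩
  · by_contra hempty
    rw [Set.not_nonempty_iff_eq_empty] at hempty
    simp [dirLabeledPackingNumber, hempty] at h
  · rintro p ⟨f, σ, hf, -⟩
    simpa [ZMod.card] using Fintype.card_le_of_surjective f hf

/-- Let `C⃗_n` be the circuit of order `n = k + x` with
`(x, n) ∉ {(1,4), (1,6)}`. For every positive integer `p` with `p ≤ λ^k(C⃗_n)`, there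
is a partition `n_1, …, n_p` of `n` into `p` positive parts such that
`Σ_i ⌊n_i(n_i − 1)/k⌋ + Σ_i Σ_{j>i} ⌊2 n_i n_j / k⌋ ≥ n`. -/
theorem exists_partition_of_dirLabeledPackingNumber (k x p : ℕ) (hk : 1 ≤ k)
    (h4 : ¬(x = 1 ∧ k + x = 4)) (h6 : ¬(x = 1 ∧ k + x = 6))
    (hp : 0 < p) (hple : p ≤ dirLabeledPackingNumber (k + x) k) :
    ∃ parts : Fin p → ℕ, (∀ i, 0 < parts i) ∧ (∑ i, parts i = k + x) ∧
      k + x ≤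
        (∑ i, parts i * (parts i - 1) / k) +
          ∑ i, ∑ j ∈ Finset.univ.filter (fun j => i < j), 2 * (parts i * parts j) / k := by
  have : NeZero (k + x) := ⟨by omega⟩
  obtain ⟨f, σ, h⟩ := exists_isDirLabeledPacking_dirLabeledPackingNumber (hp.trans_le hple)
  have : Nonempty (Fin p) := ⟨⟨0, hp⟩⟩
  exact (h.comp (Function.invFun_surjective (Fin.castLE_injective hple))).exists_partition hk
end

section
/- The circuit C⃗_6 of order 6 admits a 4-placement into the complete digraph on 6 vertices: there exist four bijections σ_1, σ_2, σ_3, σ_4 from V(C⃗_6) to the vertices of ↔K_6 whose induced images of the arc set of C⃗_6 are pairwise disjoint sets of arcs. -/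
/-- The vertex sequences of four pairwise arc-disjoint Hamiltonian circuits of the complete
digraph on `6` vertices. -/
def hamiltonianCircuitC6 : Fin 4 → Fin 6 → Fin 6 :=
  ![![0, 1, 2, 3, 4, 5], ![0, 2, 1, 3, 5, 4], ![0, 4, 1, 5, 3, 2], ![0, 5, 2, 4, 3, 1]]

/-- The positions of the vertices in the circuits `hamiltonianCircuitC6`. -/
def hamiltonianCircuitC6Inv : Fin 4 → Fin 6 → Fin 6 :=
  ![![0, 1, 2, 3, 4, 5], ![0, 2, 1, 3, 5, 4], ![0, 2, 5, 4, 1, 3], ![0, 5, 2, 4, 3, 1]]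

theorem hamiltonianCircuitC6_leftInverse : ∀ (i : Fin 4) (x : Fin 6),
    hamiltonianCircuitC6Inv i (hamiltonianCircuitC6 i x) = x := by
  decide

theorem hamiltonianCircuitC6_rightInverse : ∀ (i : Fin 4) (x : Fin 6),
    hamiltonianCircuitC6 i (hamiltonianCircuitC6Inv i x) = x := by
  decide

/-- The bijections given by the circuits `hamiltonianCircuitC6`. -/
def placementC6 (i : Fin 4) : ZMod 6 ≃ ZMod 6 where
  toFun := hamiltonianCircuitC6 i
  invFun := hamiltonianCircuitC6Inv i
  left_inv := hamiltonianCircuitC6_leftInverse i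
  right_inv := hamiltonianCircuitC6_rightInverse i

theorem placementC6_ne_succ :
    ∀ (i : Fin 4) (v : ZMod 6), placementC6 i v ≠ placementC6 i (v + 1) := by
  decide

theorem placementC6_arc_ne : ∀ i j : Fin 4, i ≠ j → ∀ v w : ZMod 6,
    placementC6 j w = placementC6 i v → placementC6 j (w + 1) ≠ placementC6 i (v + 1) := by
  decide

/-- The circuit `C⃗_6` admits a `4`-placement into the complete
digraph on `6` vertices. -/
theorem exists_four_placement_C6 :
    ∃ σ : Fin 4 → (ZMod 6 ≃ ZMod 6), IsDirPlacement 6 4 σ := by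
  refine ⟨placementC6, ?_, ?_⟩
  · rintro i _ ⟨v, rfl⟩
    exact placementC6_ne_succ i v
  · intro i j hij
    rw [Set.disjoint_left]
    rintro _ ⟨_, ⟨v, rfl⟩, rfl⟩ ⟨_, ⟨w, rfl⟩, h⟩
    obtain ⟨h₁, h₂⟩ := Prod.mk.inj h
    exact placementC6_arc_ne i j hij v w h₁ h₂
end
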